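/- arXiv:2511.06880 — 2 statements merged into one kernel-verified Lean document; each statement's English description precedes it below -/
import Mathlib

section
/- Let 𝒜 be an abelian category and let X_• be a bounded chain complex in 𝒜. Then the equality Σ_i (−1)^i [X_i] = Σ_i (−1)^i [H_i(X_•)] holds in the Grothendieck group K₀(𝒜), where H_i(X_•) denotes the i-th homology object of the complex. -/
/-!
Grothendieck group of an abelian category: quotient of the free abelian group on
isomorphism classes of objects by the subgroup generated by `[A] - [B] - [C]`
for every short exact sequence `0 → B → A → C → 0`.
-/

open CategoryTheory

universe v u

/-- The set of relations defining the Grothendieck group of an abelian category. -/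
def K0Rels (C : Type u) [Category.{v} C] [Abelian C] :
    Set (FreeAbelianGroup (Quotient (CategoryTheory.isIsomorphicSetoid C))) :=
  { x | ∃ S : ShortComplex C, S.ShortExact ∧
      x = FreeAbelianGroup.of ⟦S.X₂⟧ - FreeAbelianGroup.of ⟦S.X₁⟧ -
        FreeAbelianGroup.of ⟦S.X₃⟧ }

/-- The Grothendieck group `K₀` of an abelian category. -/
def K0 (C : Type u) [Category.{v} C] [Abelian C] : Type u :=
  FreeAbelianGroup (Quotient (CategoryTheory.isIsomorphicSetoid C)) ⧸
    AddSubgroup.closure (K0Rels C)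

noncomputable instance (C : Type u) [Category.{v} C] [Abelian C] :
    AddCommGroup (K0 C) :=
  QuotientAddGroup.Quotient.addCommGroup _

/-- The class of an object of `C` in the Grothendieck group `K₀ C`. -/
def K0.mk {C : Type u} [Category.{v} C] [Abelian C] (X : C) : K0 C :=
  QuotientAddGroup.mk (FreeAbelianGroup.of ⟦X⟧)

/-- Isomorphic objects have the same class in `K₀`. -/
theorem K0.mk_eq_of_iso {C : Type u} [Category.{v} C] [Abelian C] {A B : C} (e : A ≅ B) :
    K0.mk A = K0.mk B :=
  congrArg (fun q => QuotientAddGroup.mk (FreeAbelianGroup.of q)) (Quotient.sound ⟨e⟩)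

/-- Classes in `K₀` are additive on short exact sequences. -/
theorem K0.mk_eq_add_of_shortExact {C : Type u} [Category.{v} C] [Abelian C]
    {S : ShortComplex C} (hS : S.ShortExact) :
    K0.mk S.X₂ = K0.mk S.X₁ + K0.mk S.X₃ := by
  have h : (QuotientAddGroup.mk (FreeAbelianGroup.of ⟦S.X₂⟧ - FreeAbelianGroup.of ⟦S.X₁⟧ -
        FreeAbelianGroup.of ⟦S.X₃⟧) : K0 C) = 0 :=
    (QuotientAddGroup.eq_zero_iff _).2 (AddSubgroup.subset_closure ⟨S, hS, rfl⟩)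
  have hsub : K0.mk S.X₂ - K0.mk S.X₁ - K0.mk S.X₃ = 0 := h
  rwa [sub_sub, sub_eq_zero] at hsub

/-- The class of a zero object in `K₀` is zero. -/
theorem K0.mk_eq_zero {C : Type u} [Category.{v} C] [Abelian C] {A : C}
    (hA : Limits.IsZero A) : K0.mk A = 0 := by
  have hS : (ShortComplex.mk (0 : A ⟶ A) (0 : A ⟶ A) (by simp)).ShortExact :=
    { exact := ShortComplex.exact_of_isZero_X₂ _ hA
      mono_f := ⟨fun _ _ _ => hA.eq_of_tgt _ _⟩
      epi_g := ⟨fun _ _ _ => hA.eq_of_src _ _⟩ }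
  simpa using K0.mk_eq_add_of_shortExact hS

/-- A morphism `f : A ⟶ B` satisfies `[A] - [ker f] = [B] - [coker f]` in `K₀`. -/
theorem K0.mk_sub_mk_kernel {C : Type u} [Category.{v} C] [Abelian C] {A B : C} (f : A ⟶ B) :
    K0.mk A - K0.mk (Limits.kernel f) = K0.mk B - K0.mk (Limits.cokernel f) := by
  have h₁ : (ShortComplex.mk (Limits.kernel.ι f) (Limits.cokernel.π (Limits.kernel.ι f))
      (by simp)).ShortExact :=
    { exact := ShortComplex.exact_cokernel _
      mono_f := inferInstanceAs (Mono (Limits.kernel.ι f))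
      epi_g := inferInstanceAs (Epi (Limits.cokernel.π _)) }
  have h₂ : (ShortComplex.mk (Limits.kernel.ι (Limits.cokernel.π f)) (Limits.cokernel.π f)
      (by simp)).ShortExact :=
    { exact := ShortComplex.exact_kernel _
      mono_f := inferInstanceAs (Mono (Limits.kernel.ι _))
      epi_g := inferInstanceAs (Epi (Limits.cokernel.π f)) }
  have e₁ := K0.mk_eq_add_of_shortExact h₁
  have e₂ := K0.mk_eq_add_of_shortExact h₂
  have e₃ := K0.mk_eq_of_iso (Abelian.coimageIsoImage f)
  dsimp only [Abelian.coimage, Abelian.image] at e₁ e₂ e₃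
  rw [e₁, e₂, e₃]
  abel

/-- In a chain complex, `[X_{i+1}] - [Z_{i+1}] = [Z_i] - [H_i]` in `K₀`: both sides are the class
of the object of boundaries in degree `i`. -/
theorem K0.mk_X_sub_mk_cycles {C : Type u} [Category.{v} C] [Abelian C]
    (X : ChainComplex C ℤ) {i j : ℤ} (hij : j + 1 = i) :
    K0.mk (X.X i) - K0.mk (X.cycles i) = K0.mk (X.cycles j) - K0.mk (X.homology j) := by
  have hprev : (ComplexShape.down ℤ).prev j = i := (ComplexShape.down ℤ).prev_eq' hij
  have hnext : (ComplexShape.down ℤ).next i = j := (ComplexShape.down ℤ).next_eq' hij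
  have eZ : X.cycles i ≅ Limits.kernel (X.toCycles i j) :=
    (X.cyclesIsKernel i j hnext).conePointUniqueUpToIso (Limits.limit.isLimit _) ≪≫
      Limits.kernelIsoOfEq (X.toCycles_i i j).symm ≪≫ Limits.kernelCompMono _ _
  have eH : X.homology j ≅ Limits.cokernel (X.toCycles i j) :=
    (X.homologyIsCokernel i j hprev).coconePointUniqueUpToIso (Limits.colimit.isColimit _)
  rw [K0.mk_eq_of_iso eZ, K0.mk_eq_of_iso eH, K0.mk_sub_mk_kernel]

/-- The alternating sum of `b i + b (i - 1)` over `-n ≤ i ≤ n` telescopes. -/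
theorem sum_negOnePow_smul_add_telescope {A : Type*} [AddCommGroup A] (b : ℤ → A) (n : ℕ) :
    ∑ i ∈ Finset.Icc (-(n : ℤ)) (n : ℤ), (((-1 : ℤˣ) ^ i : ℤˣ) : ℤ) • (b i + b (i - 1)) =
      (((-1 : ℤˣ) ^ (n : ℤ) : ℤˣ) : ℤ) • (b n + b (-(n : ℤ) - 1)) := by
  induction n with
  | zero => simp
  | succ n ih =>
    have hIcc : Finset.Icc (-((n + 1 : ℕ) : ℤ)) ((n + 1 : ℕ) : ℤ) =
        insert (-(n : ℤ) - 1) (insert ((n : ℤ) + 1) (Finset.Icc (-(n : ℤ)) (n : ℤ))) := by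
      ext k
      simp only [Finset.mem_Icc, Finset.mem_insert]
      lia
    have hneg : (-1 : ℤˣ) ^ (-(n : ℤ) - 1) = (-1 : ℤˣ) ^ ((n : ℤ) + 1) := by
      rw [← neg_add', zpow_neg, ← inv_zpow, Int.units_inv_eq_self]
    rw [hIcc, Finset.sum_insert, Finset.sum_insert, ih, hneg]
    · push_cast
      rw [zpow_add_one, show (n : ℤ) + 1 - 1 = n by ring, show -((n : ℤ) + 1) = -n - 1 by ring]
      push_cast
      simp only [mul_neg, mul_one, neg_smul, smul_add]
      abel
    all_goals simp only [Finset.mem_Icc, Finset.mem_insert]; lia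

/-- For a bounded chain complex `X_•` in an abelian category,
`Σ_i (-1)^i [X_i] = Σ_i (-1)^i [H_i(X_•)]` in `K₀`. The complex is indexed by `ℤ`
and vanishes in degrees of absolute value `> n`; both sums are taken over
`-n ≤ i ≤ n`. -/
theorem alternating_sum_eq_alternating_sum_homology
    {C : Type u} [Category.{v} C] [Abelian C] (n : ℕ) (X : ChainComplex C ℤ)
    (hbdd : ∀ i : ℤ, (n : ℤ) < |i| → Limits.IsZero (X.X i)) :
    ∑ i ∈ Finset.Icc (-(n : ℤ)) (n : ℤ),
        (((-1 : ℤˣ) ^ i : ℤˣ) : ℤ) • K0.mk (X.X i) =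
      ∑ i ∈ Finset.Icc (-(n : ℤ)) (n : ℤ),
        (((-1 : ℤˣ) ^ i : ℤˣ) : ℤ) • K0.mk (X.homology i) := by
  set b : ℤ → K0 C := fun i => K0.mk (X.cycles i) - K0.mk (X.homology i) with hb
  have key : ∀ i, K0.mk (X.X i) - K0.mk (X.homology i) = b i + b (i - 1) := fun i => by
    rw [hb]
    dsimp only
    rw [← K0.mk_X_sub_mk_cycles X (sub_add_cancel i 1)]
    abel
  have hzero : ∀ i : ℤ, (n : ℤ) < |i| → K0.mk (X.X i) - K0.mk (X.cycles i) = 0 :=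
    fun i hi => by
      rw [K0.mk_eq_zero (hbdd i hi),
        K0.mk_eq_zero ((hbdd i hi).of_mono (X.iCycles i)), sub_zero]
  have htop : b n = 0 := by
    rw [hb]
    dsimp only
    rw [← K0.mk_X_sub_mk_cycles X (i := (n : ℤ) + 1) rfl]
    exact hzero _ (by rw [lt_abs]; lia)
  have hbot : b (-(n : ℤ) - 1) = 0 := by
    have hX := hbdd (-(n : ℤ) - 1) (by rw [lt_abs]; lia)
    have hZ := hX.of_mono (X.iCycles _)
    rw [hb]
    dsimp only
    rw [K0.mk_eq_zero hZ, K0.mk_eq_zero (hZ.of_epi (X.homologyπ _)), sub_zero]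
  rw [← sub_eq_zero, ← Finset.sum_sub_distrib]
  simp only [← smul_sub, key]
  rw [sum_negOnePow_smul_add_telescope, htop, hbot, add_zero, smul_zero]
end

section
/- Let F : 𝒜 → 𝒟 be a left exact additive functor between abelian categories, where 𝒜 has enough injectives so that the right derived functors R^iF exist, and suppose that for every object X of 𝒜 one has R^iF(X) = 0 for all sufficiently large i (depending on X). Then the assignment [X] ↦ Σ_{i ≥ 0} (−1)^i [R^iF(X)] defines a group homomorphism F_! : K₀(𝒜) → K₀(𝒟). -/
/-!
Grothendieck group of an abelian category: quotient of the free abelian group on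
isomorphism classes of objects by the subgroup generated by `[A] - [B] - [C]`
for every short exact sequence `0 → B → A → C → 0`.
-/

open CategoryTheory

universe v u v' u'

section

open Limits

namespace K0

variable {C : Type u} [Category.{v} C] [Abelian C]

lemma mk_eq_of_iso_s7 {X Y : C} (e : X ≅ Y) : mk X = mk Y :=
  congrArg (fun q ↦ QuotientAddGroup.mk (FreeAbelianGroup.of q)) (Quotient.sound ⟨e⟩)

lemma mk_eq_add {S : ShortComplex C} (hS : S.ShortExact) : mk S.X₂ = mk S.X₁ + mk S.X₃ := by
  have h : (QuotientAddGroup.mk' (AddSubgroup.closure (K0Rels C)))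
      (FreeAbelianGroup.of ⟦S.X₂⟧ - FreeAbelianGroup.of ⟦S.X₁⟧ - FreeAbelianGroup.of ⟦S.X₃⟧) = 0 :=
    (QuotientAddGroup.eq_zero_iff _).2 (AddSubgroup.subset_closure ⟨S, hS, rfl⟩)
  rw [map_sub, map_sub, sub_sub, sub_eq_zero] at h
  exact h

lemma mk_eq_zero_s7 {X : C} (hX : IsZero X) : mk X = 0 := by
  have h : (ShortComplex.mk (0 : X ⟶ X) (0 : X ⟶ X) (by simp)).ShortExact :=
    { exact := ShortComplex.exact_of_isZero_X₂ _ hX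
      mono_f := ⟨fun _ _ _ ↦ hX.eq_of_tgt _ _⟩
      epi_g := ⟨fun _ _ _ ↦ hX.eq_of_src _ _⟩ }
  simpa using mk_eq_add h

/-- The relation in `K₀` given by an exact sequence `0 ⟶ X₁ ⟶ X₂ ⟶ X₃ ⟶ X₄ ⟶ 0`. -/
lemma mk_add_mk_eq_of_exact {X₁ X₂ X₃ X₄ : C} (f : X₁ ⟶ X₂) (g : X₂ ⟶ X₃) (h : X₃ ⟶ X₄)
    [Mono f] [Epi h] (w : f ≫ g = 0) (w' : g ≫ h = 0)
    (hf : (ShortComplex.mk f g w).Exact) (hg : (ShortComplex.mk g h w').Exact) :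
    mk X₁ + mk X₃ = mk X₂ + mk X₄ := by
  have hepi : Epi (kernel.lift h g w') := hg.epi_kernelLift
  have wl : f ≫ kernel.lift h g w' = 0 := by
    rw [← cancel_mono (kernel.ι h)]; simpa using w
  have h₁ : (ShortComplex.mk f (kernel.lift h g w') wl).ShortExact :=
    { exact := by
        let α : ShortComplex.mk f (kernel.lift h g w') wl ⟶ ShortComplex.mk f g w :=
          { τ₁ := 𝟙 _, τ₂ := 𝟙 _, τ₃ := kernel.ι h }
        have : Mono α.τ₃ := inferInstanceAs (Mono (kernel.ι h))
        exact (ShortComplex.exact_iff_of_epi_of_isIso_of_mono α).2 hf }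
  have h₂ : (ShortComplex.mk (kernel.ι h) h (kernel.condition h)).ShortExact :=
    { exact := ShortComplex.exact_kernel h }
  have e₁ := mk_eq_add h₁
  have e₂ := mk_eq_add h₂
  dsimp at e₁ e₂
  rw [e₁, e₂, add_assoc]

end K0

namespace CategoryTheory

lemma ShortComplex.ShortExact.exists_injective_rotation {C : Type u} [Category.{v} C] [Abelian C]
    [EnoughInjectives C] {S : ShortComplex C} (hS : S.ShortExact) :
    ∃ (I X Y : C) (_ : Injective I) (b : S.X₂ ⟶ I) (p : I ⟶ X) (q : I ⟶ Y) (c : S.X₃ ⟶ X)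
      (r : X ⟶ Y) (w₁ : (S.f ≫ b) ≫ p = 0) (w₂ : b ≫ q = 0) (w₃ : c ≫ r = 0),
      (ShortComplex.mk _ _ w₁).ShortExact ∧ (ShortComplex.mk _ _ w₂).ShortExact ∧
      (ShortComplex.mk _ _ w₃).ShortExact ∧ b ≫ p = S.g ≫ c ∧ p ≫ r = q := by
  have := hS.mono_f
  have := hS.epi_g
  let b := Injective.ι S.X₂
  have hc : S.f ≫ b ≫ cokernel.π (S.f ≫ b) = 0 := by
    rw [← Category.assoc]; exact cokernel.condition _
  let c : S.X₃ ⟶ cokernel (S.f ≫ b) := hS.exact.desc (b ≫ cokernel.π (S.f ≫ b)) hc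
  have fac : S.g ≫ c = b ≫ cokernel.π (S.f ≫ b) := hS.exact.g_desc _ _
  let r : cokernel (S.f ≫ b) ⟶ cokernel b := cokernel.desc _ (cokernel.π b) (by simp)
  have facr : cokernel.π (S.f ≫ b) ≫ r = cokernel.π b := cokernel.π_desc _ _ _
  have hr : Epi r := by
    have : Epi (cokernel.π (S.f ≫ b) ≫ r) := by rw [facr]; infer_instance
    exact epi_of_epi (cokernel.π (S.f ≫ b)) r
  have w₃ : c ≫ r = 0 := by
    rw [← cancel_epi S.g, ← Category.assoc, fac, Category.assoc, facr, cokernel.condition,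
      comp_zero]
  have e₁ := ShortComplex.exact_cokernel (S.f ≫ b)
  have e₂ := ShortComplex.exact_cokernel b
  refine ⟨_, _, _, inferInstance, b, cokernel.π (S.f ≫ b), cokernel.π b, c, r,
    cokernel.condition _, cokernel.condition _, w₃, { exact := e₁ }, { exact := e₂ }, ?_,
    fac.symm, facr⟩
  have hm : Mono c := by
    refine Preadditive.mono_of_cancel_zero _ fun {A} z hz ↦ ?_
    obtain ⟨A₁, π₁, _, y, hy⟩ := surjective_up_to_refinements_of_epi S.g z
    obtain ⟨A₂, π₂, _, x, hx⟩ := e₁.exact_up_to_refinements (y ≫ b) (by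
      dsimp; rw [Category.assoc, ← fac, ← Category.assoc, ← hy, Category.assoc, hz, comp_zero])
    dsimp at hx
    have hx' : π₂ ≫ y = x ≫ S.f := by
      rw [← cancel_mono b]; simpa using hx
    rw [← cancel_epi π₁, ← cancel_epi π₂, hy, ← Category.assoc π₂ y, hx']
    simp
  refine { exact := ?_ }
  rw [ShortComplex.exact_iff_exact_up_to_refinements]
  intro A x hx
  dsimp at x hx
  obtain ⟨A₁, π₁, _, i, hi⟩ := surjective_up_to_refinements_of_epi (cokernel.π (S.f ≫ b)) x
  have hib : i ≫ cokernel.π b = 0 := by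
    rw [← facr, ← Category.assoc, ← hi, Category.assoc, hx, comp_zero]
  obtain ⟨A₂, π₂, _, y, hy⟩ := e₂.exact_up_to_refinements i hib
  dsimp at hy
  refine ⟨A₂, π₂ ≫ π₁, inferInstance, y ≫ S.g, ?_⟩
  dsimp
  rw [Category.assoc, Category.assoc, fac, hi, ← Category.assoc, hy, Category.assoc]

namespace InjectiveResolution

variable {C : Type u} [Category.{v} C] [Abelian C]

/-- The augmentation of an injective resolution, as a morphism in the ambient category. -/
def ι₀ {X : C} (J : InjectiveResolution X) : X ⟶ J.cocomplex.X 0 := J.ι.f 0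

lemma ι₀_comp_d {X : C} (J : InjectiveResolution X) : J.ι₀ ≫ J.cocomplex.d 0 1 = 0 :=
  J.ι_f_zero_comp_complex_d

instance {X : C} (J : InjectiveResolution X) : Mono J.ι₀ := inferInstanceAs (Mono (J.ι.f 0))

/-- The augmentation is the kernel of the first differential of an injective resolution. -/
noncomputable def isLimitι₀ {X : C} (J : InjectiveResolution X) :
    IsLimit (KernelFork.ofι J.ι₀ J.ι₀_comp_d) :=
  J.isLimitKernelFork

lemma exact_ι₀_d {X : C} (J : InjectiveResolution X) :
    (ShortComplex.mk _ _ J.ι₀_comp_d).Exact :=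
  ShortComplex.exact_of_f_is_kernel _ J.isLimitι₀

lemma augment_condition {S : ShortComplex C} (J : InjectiveResolution S.X₃) :
    (S.g ≫ J.ι₀) ≫ J.cocomplex.d 0 1 = 0 := by
  rw [Category.assoc, J.ι₀_comp_d, comp_zero]

lemma f_comp_augment_d {S : ShortComplex C} (J : InjectiveResolution S.X₃) :
    S.f ≫ S.g ≫ J.ι₀ = 0 := by
  rw [S.zero_assoc, zero_comp]

/-- Given a short exact sequence `0 ⟶ X₁ ⟶ X₂ ⟶ X₃ ⟶ 0` with `X₂` injective, an injective
resolution of `X₃` extends to one of `X₁`. -/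
noncomputable def augment {S : ShortComplex C} (hS : S.ShortExact) [Injective S.X₂]
    (J : InjectiveResolution S.X₃) : InjectiveResolution S.X₁ where
  cocomplex := CochainComplex.augment J.cocomplex (S.g ≫ J.ι₀) J.augment_condition
  injective n := by
    cases n
    · assumption
    · exact J.injective _
  ι := (CochainComplex.fromSingle₀Equiv _ _).symm ⟨S.f, f_comp_augment_d J⟩
  quasiIso := ⟨fun n ↦ by
    have := hS.mono_f
    have := hS.epi_g
    rcases n with _ | n
    · rw [CochainComplex.quasiIsoAt₀_iff, ShortComplex.quasiIso_iff_of_zeros]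
      · have h₀ := CochainComplex.fromSingle₀Equiv_symm_apply_f_zero
          (C := CochainComplex.augment J.cocomplex (S.g ≫ J.ι₀) J.augment_condition)
          S.f J.f_comp_augment_d
        let α : S ⟶ ShortComplex.mk S.f (S.g ≫ J.ι₀) J.f_comp_augment_d :=
          { τ₁ := 𝟙 _, τ₂ := 𝟙 _, τ₃ := J.ι₀ }
        have : Mono α.τ₃ := inferInstanceAs (Mono (J.ι₀))
        refine (ShortComplex.exact_and_mono_f_iff_of_iso ?_).2
          ⟨(ShortComplex.exact_iff_of_epi_of_isIso_of_mono α).1 hS.exact, hS.mono_f⟩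
        exact ShortComplex.isoMk (Iso.refl _) (Iso.refl _) (Iso.refl _)
          ((Category.id_comp S.f).trans (h₀.symm.trans (Category.comp_id (Y := S.X₂) _).symm))
          ((Category.id_comp _).trans (Category.comp_id _).symm)
      all_goals rfl
    · rw [quasiIsoAt_iff_exactAt _ _ (CochainComplex.exactAt_succ_single_obj _ _),
        HomologicalComplex.exactAt_iff' _ n (n + 1) (n + 2) (by simp) (by simp)]
      rcases n with _ | n
      · let α : ShortComplex.mk (S.g ≫ J.ι₀) (J.cocomplex.d 0 1) J.augment_condition ⟶
            ShortComplex.mk _ _ J.ι₀_comp_d :=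
          { τ₁ := S.g, τ₂ := 𝟙 _, τ₃ := 𝟙 _ }
        have : Epi α.τ₁ := hS.epi_g
        exact (ShortComplex.exact_iff_of_epi_of_isIso_of_mono α).2 J.exact_ι₀_d
      · exact J.exact_succ n⟩

end InjectiveResolution

namespace Functor

variable {C : Type u} [Category.{v} C] [Abelian C] [EnoughInjectives C]
  {D : Type u'} [Category.{v'} D] [Abelian D] (F : C ⥤ D) [F.Additive]

/-- The dimension shift `Rⁱ⁺²F(X₁) ≅ Rⁱ⁺¹F(X₃)` for a short exact sequence
`0 ⟶ X₁ ⟶ X₂ ⟶ X₃ ⟶ 0` with `X₂` injective. -/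
noncomputable def rightDerivedShiftIso {S : ShortComplex C} (hS : S.ShortExact) [Injective S.X₂]
    (i : ℕ) : (F.rightDerived (i + 2)).obj S.X₁ ≅ (F.rightDerived (i + 1)).obj S.X₃ :=
  let J := InjectiveResolution.of S.X₃
  (J.augment hS).isoRightDerivedObj F (i + 2) ≪≫
    ShortComplex.homologyMapIso
      (((F.mapHomologicalComplex _).obj (J.augment hS).cocomplex).isoSc' (i + 1) (i + 2) (i + 3)
        (by simp) (by simp)) ≪≫
    (ShortComplex.homologyMapIso
      (((F.mapHomologicalComplex _).obj J.cocomplex).isoSc' i (i + 1) (i + 2)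
        (by simp) (by simp))).symm ≪≫
    (J.isoRightDerivedObj F (i + 1)).symm

/-- For a short exact sequence `0 ⟶ X₁ ⟶ X₂ ⟶ X₃ ⟶ 0` with `X₂` injective, the sequence
`F(X₂) ⟶ F(X₃) ⟶ R¹F(X₁) ⟶ 0` is exact. -/
lemma exists_exact_rightDerived_one [PreservesFiniteLimits F] {S : ShortComplex C}
    (hS : S.ShortExact) [Injective S.X₂] :
    ∃ (δ : F.obj S.X₃ ⟶ (F.rightDerived 1).obj S.X₁) (w : F.map S.g ≫ δ = 0),
      Epi δ ∧ (ShortComplex.mk _ _ w).Exact := by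
  let J := InjectiveResolution.of S.X₃
  let T : ShortComplex D := ShortComplex.mk (F.map (S.g ≫ J.ι₀)) (F.map (J.cocomplex.d 0 1))
    (by rw [← F.map_comp, J.augment_condition, F.map_zero])
  let e : T.homology ≅ (F.rightDerived 1).obj S.X₁ :=
    (ShortComplex.homologyMapIso
      (((F.mapHomologicalComplex _).obj (J.augment hS).cocomplex).isoSc' 0 1 2
        (by simp) (by simp))).symm ≪≫ ((J.augment hS).isoRightDerivedObj F 1).symm
  have hk := KernelFork.mapIsLimit _ J.isLimitι₀ F
  let k : F.obj S.X₃ ≅ T.cycles := hk.conePointUniqueUpToIso T.cyclesIsKernel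
  have hki : k.hom ≫ T.iCycles = F.map (J.ι₀) :=
    hk.conePointUniqueUpToIso_hom_comp T.cyclesIsKernel WalkingParallelPair.zero
  have hkt : F.map S.g ≫ k.hom = T.toCycles := by
    rw [← cancel_mono T.iCycles, Category.assoc, hki, T.toCycles_i, ← F.map_comp]
  refine ⟨k.hom ≫ T.homologyπ ≫ e.hom, ?_, inferInstance, ?_⟩
  · rw [← Category.assoc, hkt, T.toCycles_comp_homologyπ_assoc, zero_comp]
  · have h := ShortComplex.exact_of_g_is_cokernel
      (ShortComplex.mk T.toCycles T.homologyπ (by simp)) T.homologyIsCokernel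
    refine (ShortComplex.exact_iff_of_iso ?_).1 h
    exact ShortComplex.isoMk (Iso.refl _) k.symm e (by simp [← hkt]) (by simp)

lemma shortExact_map_of_isZero_rightDerived_one [PreservesFiniteLimits F] {S : ShortComplex C}
    (hS : S.ShortExact) (h : IsZero ((F.rightDerived 1).obj S.X₁)) : (S.map F).ShortExact := by
  have := hS.mono_f
  obtain ⟨I, X, Y, _, b, p, q, c, r, w₁, w₂, w₃, h₁, h₂, h₃, hbp, hpr⟩ :=
    hS.exists_injective_rotation
  obtain ⟨δ, w, _, hδ⟩ := F.exists_exact_rightDerived_one h₁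
  have hp : Epi (F.map p) := hδ.epi_f (h.eq_of_tgt _ _)
  have := h₂.mono_f
  have := h₃.mono_f
  have hc : Mono (F.map c) := inferInstance
  have hb := h₂.exact.map_of_mono_of_preservesKernel F inferInstance inferInstance
  refine { exact := hS.exact.map_of_mono_of_preservesKernel F inferInstance inferInstance,
           mono_f := inferInstanceAs (Mono (F.map S.f)), epi_g := ?_ }
  suffices Epi (F.map S.g) from this
  rw [epi_iff_surjective_up_to_refinements]
  intro A z
  obtain ⟨A₁, π₁, _, i, hi⟩ := surjective_up_to_refinements_of_epi (F.map p) (z ≫ F.map c)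
  have hiq : i ≫ F.map q = 0 := by
    rw [← hpr, F.map_comp, ← Category.assoc, ← hi, Category.assoc, Category.assoc, ← F.map_comp,
      w₃, F.map_zero, comp_zero, comp_zero]
  obtain ⟨A₂, π₂, _, y, hy⟩ : ∃ (A₂ : D) (π₂ : A₂ ⟶ A₁) (_ : Epi π₂) (y : A₂ ⟶ F.obj S.X₂),
      π₂ ≫ i = y ≫ F.map b := hb.exact_up_to_refinements i hiq
  refine ⟨A₂, π₂ ≫ π₁, inferInstance, y, ?_⟩
  rw [← cancel_mono (F.map c), Category.assoc, Category.assoc, hi, Category.assoc, ← F.map_comp, ← hbp, F.map_comp,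
    ← Category.assoc, hy, Category.assoc]

/-- The alternating sum of the classes of the derived functors of `F` at `X` in degrees `≤ N`. -/
noncomputable def eulerSum (N : ℕ) (X : C) : K0 D :=
  ∑ i ∈ Finset.range (N + 1), ((-1 : ℤ) ^ i) • K0.mk ((F.rightDerived i).obj X)

lemma eulerSum_eq_of_iso (N : ℕ) {X Y : C} (e : X ≅ Y) : F.eulerSum N X = F.eulerSum N Y :=
  Finset.sum_congr rfl fun i _ ↦ by rw [K0.mk_eq_of_iso_s7 ((F.rightDerived i).mapIso e)]

lemma eulerSum_eq_of_le {N M : ℕ} (hNM : N ≤ M) {X : C}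
    (h : ∀ i, N < i → IsZero ((F.rightDerived i).obj X)) : F.eulerSum N X = F.eulerSum M X := by
  refine Finset.sum_subset (Finset.range_mono (by lia)) fun i _ hi ↦ ?_
  rw [K0.mk_eq_zero_s7 (h i (by simpa using hi)), smul_zero]

lemma eulerSum_succ_add_eulerSum [PreservesFiniteLimits F] {S : ShortComplex C}
    (hS : S.ShortExact) [Injective S.X₂] (N : ℕ) :
    F.eulerSum (N + 1) S.X₁ + F.eulerSum N S.X₃ = K0.mk (F.obj S.X₂) := by
  have := hS.mono_f
  obtain ⟨δ, w, _, hδ⟩ := F.exists_exact_rightDerived_one hS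
  have key := K0.mk_add_mk_eq_of_exact (F.map S.f) (F.map S.g) δ
    (by rw [← F.map_comp, S.zero, F.map_zero]) w
    (hS.exact.map_of_mono_of_preservesKernel F inferInstance inferInstance) hδ
  have h₀ (X : C) : K0.mk ((F.rightDerived 0).obj X) = K0.mk (F.obj X) :=
    K0.mk_eq_of_iso_s7 (F.rightDerivedZeroIsoSelf.app X)
  have hsum : ∑ i ∈ Finset.range N,
        ((-1 : ℤ) ^ (i + 1 + 1)) • K0.mk ((F.rightDerived (i + 1 + 1)).obj S.X₁) =
      -∑ i ∈ Finset.range N, ((-1 : ℤ) ^ (i + 1)) • K0.mk ((F.rightDerived (i + 1)).obj S.X₃) := by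
    rw [← Finset.sum_neg_distrib]
    refine Finset.sum_congr rfl fun i _ ↦ ?_
    rw [K0.mk_eq_of_iso_s7 (F.rightDerivedShiftIso hS i), pow_succ _ (i + 1), mul_neg_one, neg_smul]
  rw [eulerSum, eulerSum, Finset.sum_range_succ', Finset.sum_range_succ',
    Finset.sum_range_succ' _ N, hsum, h₀, h₀]
  simp only [zero_add, pow_zero, pow_one, one_smul, neg_smul]
  rw [← sub_eq_iff_eq_add.2 key.symm]
  abel

lemma eulerSum_additive [PreservesFiniteLimits F] (N : ℕ) {S : ShortComplex C}
    (hS : S.ShortExact)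
    (h₁ : ∀ i, N < i → IsZero ((F.rightDerived i).obj S.X₁))
    (h₂ : ∀ i, N < i → IsZero ((F.rightDerived i).obj S.X₂))
    (h₃ : ∀ i, N < i → IsZero ((F.rightDerived i).obj S.X₃)) :
    F.eulerSum N S.X₂ = F.eulerSum N S.X₁ + F.eulerSum N S.X₃ := by
  induction N generalizing S with
  | zero =>
    have h := K0.mk_eq_add (F.shortExact_map_of_isZero_rightDerived_one hS (h₁ 1 one_pos))
    simpa [eulerSum, K0.mk_eq_of_iso_s7 (F.rightDerivedZeroIsoSelf.app _)] using h
  | succ N ih =>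
    have shift {T : ShortComplex C} (hT : T.ShortExact) (_ : Injective T.X₂)
        (h : ∀ i, N + 1 < i → IsZero ((F.rightDerived i).obj T.X₁)) (i : ℕ) (hi : N < i) :
        IsZero ((F.rightDerived i).obj T.X₃) := by
      obtain ⟨j, rfl⟩ := Nat.exists_eq_succ_of_ne_zero (Nat.ne_zero_of_lt hi)
      exact (h (j + 2) (by lia)).of_iso (F.rightDerivedShiftIso hT j).symm
    obtain ⟨I, X, Y, _, b, p, q, c, r, _, _, _, hX, hY, hZ, -⟩ := hS.exists_injective_rotation
    obtain ⟨I', Z', X', _, b', p', q', c', r', _, _, _, hZ', hX', hY', -⟩ :=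
      hZ.exists_injective_rotation
    have vX := shift hX ‹_› h₁
    have vY := shift hY ‹_› h₂
    have vZ' := shift hZ' ‹_› h₃
    have vX' := shift hX' ‹_› fun i hi ↦ vX i (by lia)
    have e := ih hY' vY vZ' vX'
    have eX := F.eulerSum_succ_add_eulerSum hX N
    have eY := F.eulerSum_succ_add_eulerSum hY N
    have eZ' := F.eulerSum_succ_add_eulerSum hZ' N
    have eX' := F.eulerSum_succ_add_eulerSum hX' N
    have eN := F.eulerSum_eq_of_le (Nat.le_succ N) vX
    dsimp at e eX eY eZ' eX' eN
    rw [← eN] at eX'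
    rw [eq_sub_of_add_eq eX, eq_sub_of_add_eq eY, eq_sub_of_add_eq eZ', e, ← eX']
    abel

end Functor

end CategoryTheory

end

/-- Let `F : 𝒜 ⥤ 𝒟` be a left exact additive functor between
abelian categories, where `𝒜` has enough injectives (so the right derived
functors `R^iF` exist), and suppose that for every object `X` the objects
`R^iF(X)` vanish for all sufficiently large `i`.  Then `[X] ↦ Σᵢ (-1)^i [R^iF(X)]`
defines a group homomorphism `F_! : K₀(𝒜) → K₀(𝒟)`. -/
theorem euler_characteristic_of_derived_functor_induces_map_on_K0
    {C : Type u} [Category.{v} C] [Abelian C] [EnoughInjectives C]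
    {D : Type u'} [Category.{v'} D] [Abelian D]
    (F : C ⥤ D) [F.Additive] [Limits.PreservesFiniteLimits F]
    (hvanish : ∀ X : C, ∃ N : ℕ, ∀ i : ℕ, N < i →
      Limits.IsZero ((F.rightDerived i).obj X)) :
    ∃ φ : K0 C →+ K0 D, ∀ (X : C) (N : ℕ),
      (∀ i : ℕ, N < i → Limits.IsZero ((F.rightDerived i).obj X)) →
      φ (K0.mk X) =
        ∑ i ∈ Finset.range (N + 1),
          ((-1 : ℤ) ^ i) • K0.mk ((F.rightDerived i).obj X) := by
  choose n hn using hvanish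
  have heq (X : C) (N : ℕ) (h : ∀ i, N < i → Limits.IsZero ((F.rightDerived i).obj X)) :
      F.eulerSum (n X) X = F.eulerSum N X := by
    rw [F.eulerSum_eq_of_le (le_max_left (n X) N) (hn X),
      F.eulerSum_eq_of_le (le_max_right (n X) N) h]
  let χ : Quotient (isIsomorphicSetoid C) → K0 D :=
    Quotient.lift (fun X ↦ F.eulerSum (n X) X) fun X Y ⟨e⟩ ↦ by
      rw [heq X (n Y) fun i hi ↦ (hn Y i hi).of_iso ((F.rightDerived i).mapIso e)]
      exact F.eulerSum_eq_of_iso _ e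
  have hχ : AddSubgroup.closure (K0Rels C) ≤ (FreeAbelianGroup.lift χ).ker := by
    rw [AddSubgroup.closure_le]
    rintro _ ⟨S, hS, rfl⟩
    let N := max (n S.X₁) (max (n S.X₂) (n S.X₃))
    have h₁ : ∀ i, N < i → Limits.IsZero ((F.rightDerived i).obj S.X₁) :=
      fun i hi ↦ hn _ i (by lia)
    have h₂ : ∀ i, N < i → Limits.IsZero ((F.rightDerived i).obj S.X₂) :=
      fun i hi ↦ hn _ i (by lia)
    have h₃ : ∀ i, N < i → Limits.IsZero ((F.rightDerived i).obj S.X₃) :=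
      fun i hi ↦ hn _ i (by lia)
    have h := F.eulerSum_additive N hS h₁ h₂ h₃
    rw [← heq _ N h₁, ← heq _ N h₂, ← heq _ N h₃] at h
    change FreeAbelianGroup.lift χ _ = 0
    rw [map_sub, map_sub, FreeAbelianGroup.lift_apply_of, FreeAbelianGroup.lift_apply_of,
      FreeAbelianGroup.lift_apply_of, sub_sub, sub_eq_zero]
    exact h
  refine ⟨QuotientAddGroup.lift _ (FreeAbelianGroup.lift χ) hχ, fun X N h ↦ ?_⟩
  exact (FreeAbelianGroup.lift_apply_of χ _).trans (heq X N h)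
end
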